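/- arXiv:2605.07518 — 2 statements merged into one kernel-verified Lean document; each statement's English description precedes it below -/
import Mathlib

section
/- (Grover rotation lemma.) One has |φ_a⟩ = |π⟩, and for every θ ∈ ℝ, U_π U_f |φ_θ⟩ = |φ_{θ+2a}⟩; that is, one Grover iteration rotates the state (sin θ)|good⟩ + (cos θ)|bad⟩ to (sin(θ+2a))|good⟩ + (cos(θ+2a))|bad⟩. -/
open scoped ComplexInnerProductSpace

/-- The reflection in the hyperplane orthogonal to `g` followed by the reflection in the line through
`sin a • g + cos a • b` is the rotation by `2 * a` of the plane with orthonormal basis `g`, `b`. -/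
theorem reflection_comp_reflection_eq_rotation {E : Type*} [NormedAddCommGroup E]
    [InnerProductSpace ℂ E] {g b : E} (hg : ⟪g, g⟫ = 1) (hb : ⟪b, b⟫ = 1) (hgb : ⟪g, b⟫ = 0)
    {p x y : E} {a θ : ℝ} (hp : p = (Real.sin a : ℂ) • g + (Real.cos a : ℂ) • b)
    (hx : x = (Real.sin θ : ℂ) • g + (Real.cos θ : ℂ) • b) (hy : y = x - (2 * ⟪g, x⟫) • g) :
    (2 * ⟪p, y⟫) • p - y =
      (Real.sin (θ + 2 * a) : ℂ) • g + (Real.cos (θ + 2 * a) : ℂ) • b := by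
  have hbg : ⟪b, g⟫ = 0 := inner_eq_zero_symm.mp hgb
  have hy' : y = (-Real.sin θ : ℂ) • g + (Real.cos θ : ℂ) • b := by
    have hgx : ⟪g, x⟫ = Real.sin θ := by
      rw [hx, inner_add_right, inner_smul_right, inner_smul_right, hg, hgb]
      ring
    rw [hy, hgx, hx]
    module
  have hpy : ⟪p, y⟫ = (Real.cos a * Real.cos θ - Real.sin a * Real.sin θ : ℂ) := by
    rw [hp, hy']
    simp only [inner_add_left, inner_add_right, inner_smul_left, inner_smul_right, hg, hb, hgb, hbg,
      Complex.conj_ofReal]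
    ring
  have hsq : (Real.sin a : ℂ) ^ 2 + (Real.cos a : ℂ) ^ 2 = 1 := by
    exact_mod_cast Real.sin_sq_add_cos_sq a
  have hsin : (Real.sin (θ + 2 * a) : ℂ) =
      2 * (Real.cos a * Real.cos θ - Real.sin a * Real.sin θ) * Real.sin a + Real.sin θ := by
    rw [Real.sin_add, Real.sin_two_mul, Real.cos_two_mul]
    push_cast [-Complex.ofReal_sin, -Complex.ofReal_cos]
    linear_combination 2 * (Real.sin θ : ℂ) * hsq
  have hcos : (Real.cos (θ + 2 * a) : ℂ) =
      2 * (Real.cos a * Real.cos θ - Real.sin a * Real.sin θ) * Real.cos a - Real.cos θ := by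
    rw [Real.cos_add, Real.sin_two_mul, Real.cos_two_mul]
    push_cast [-Complex.ofReal_sin, -Complex.ofReal_cos]
    ring
  rw [hpy, hsin, hcos, hp, hy']
  module

/-- The cosine of the Grover angle `arcsin (1 / √N)` is `√(N - 1) / √N`. -/
theorem cos_arcsin_inv_sqrt {x : ℝ} (hx : 0 < x) :
    Real.cos (Real.arcsin (√x)⁻¹) = √(x - 1) / √x := by
  rw [Real.cos_arcsin, ← Real.sqrt_div' _ hx.le, inv_pow, Real.sq_sqrt hx.le]
  congr 1
  field_simp

/-- Grover rotation lemma: `|φ_a⟩ = |π⟩`, and one Grover iteration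
`U_π U_f` rotates `|φ_θ⟩` to `|φ_{θ+2a}⟩`. -/
theorem grover_rotation (N : ℕ) (hN : 2 ≤ N) (m : Fin N) :
    let e : Fin N → EuclideanSpace ℂ (Fin N) := fun i => EuclideanSpace.single i 1
    let π' : EuclideanSpace ℂ (Fin N) := ((Real.sqrt N)⁻¹ : ℂ) • ∑ i, e i
    let Uf : EuclideanSpace ℂ (Fin N) → EuclideanSpace ℂ (Fin N) :=
      fun x => x - (2 * ⟪e m, x⟫) • e m
    let Uπ : EuclideanSpace ℂ (Fin N) → EuclideanSpace ℂ (Fin N) :=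
      fun x => (2 * ⟪π', x⟫) • π' - x
    let a : ℝ := Real.arcsin ((Real.sqrt N)⁻¹)
    let good : EuclideanSpace ℂ (Fin N) := e m
    let bad : EuclideanSpace ℂ (Fin N) :=
      ((Real.sqrt ((N : ℝ) - 1))⁻¹ : ℂ) • ∑ i ∈ Finset.univ.filter (· ≠ m), e i
    let φ : ℝ → EuclideanSpace ℂ (Fin N) :=
      fun θ => (Real.sin θ : ℂ) • good + (Real.cos θ : ℂ) • bad
    φ a = π' ∧ ∀ θ : ℝ, Uπ (Uf (φ θ)) = φ (θ + 2 * a) := by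
  intro e π' Uf Uπ a good bad φ
  have hN' : (2 : ℝ) ≤ N := by exact_mod_cast hN
  have hs : √((N : ℝ) - 1) ≠ 0 := (Real.sqrt_pos.mpr (by linarith)).ne'
  have he : ∀ i j, ⟪e i, e j⟫ = if i = j then 1 else 0 :=
    orthonormal_iff_ite.mp (EuclideanSpace.orthonormal_single (𝕜 := ℂ) (ι := Fin N))
  have hgood : ⟪good, good⟫ = 1 := (he m m).trans (if_pos rfl)
  have hgood_bad : ⟪good, bad⟫ = 0 := by
    simp [good, bad, he]
  have hbad : ⟪bad, bad⟫ = 1 := by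
    have hcard : ((Finset.univ.filter (· ≠ m)).card : ℂ) = ((√((N : ℝ) - 1) : ℝ) : ℂ) ^ 2 := by
      rw [← Complex.ofReal_pow, Real.sq_sqrt (by linarith), Finset.filter_ne',
        Finset.card_erase_of_mem (Finset.mem_univ m), Finset.card_univ, Fintype.card_fin,
        Nat.cast_sub (by lia)]
      push_cast
      rfl
    have hsum : ⟪∑ i ∈ Finset.univ.filter (· ≠ m), e i, ∑ i ∈ Finset.univ.filter (· ≠ m), e i⟫ =
        ((Finset.univ.filter (· ≠ m)).card : ℂ) := by
      simp only [sum_inner, inner_sum, he, Finset.sum_ite_eq']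
      rw [Finset.sum_congr rfl fun i hi => if_pos hi]
      simp
    have hs' : ((√((N : ℝ) - 1) : ℝ) : ℂ) ≠ 0 := by exact_mod_cast hs
    simp only [bad]
    rw [inner_smul_left, inner_smul_right, hsum, hcard, map_inv₀, Complex.conj_ofReal]
    field_simp
  have hφ : φ a = π' := by
    have hsin : Real.sin a = (√(N : ℝ))⁻¹ := by
      refine Real.sin_arcsin (by linarith [inv_nonneg.mpr (Real.sqrt_nonneg (N : ℝ))]) ?_
      exact inv_le_one_of_one_le₀ (Real.one_le_sqrt.mpr (by linarith))
    have hcos : Real.cos a * (√((N : ℝ) - 1))⁻¹ = (√(N : ℝ))⁻¹ := by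
      rw [cos_arcsin_inv_sqrt (by linarith)]
      field_simp
    simp only [φ, bad, good, π']
    rw [smul_smul, ← Complex.ofReal_inv, ← Complex.ofReal_inv, ← Complex.ofReal_mul, hcos, hsin,
      ← smul_add, Finset.filter_ne', Finset.add_sum_erase _ _ (Finset.mem_univ m)]
  exact ⟨hφ, fun θ => reflection_comp_reflection_eq_rotation hgood hbad hgood_bad hφ.symm rfl rfl⟩
end

section
/- (Average query weight of Grover's algorithm, Lemma on weighted averages.) There exist constants c₁, c₂ > 0 and a natural number N₀ such that for every N ≥ N₀, every marked element m ∈ Fin N, and every function τ : Fin N → ℝ with τ_i ≥ 0 for all i, one has c₁·( (1/(N−1)) ∑_{i ≠ m} τ_i + τ_m ) ≤ ∑_{i ∈ [N]} q̄_i · τ_i ≤ c₂·( (1/(N−1)) ∑_{i ≠ m} τ_i + τ_m ), where Q is the nearest integer to (π/4)√N and q̄_i = (1/Q) ∑_{t=1}^{Q} |⟨e_i, (U_π U_f)^{t−1}|π⟩⟩|² is the average query weight of i. -/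
open scoped ComplexInnerProductSpace

/-- The vector `sin φ • e_m + cos φ tan θ • ∑_{i ≠ m} e_i`. When `sin θ = 1 / √N` this is the unit
vector at angle `φ` in the plane spanned by `e_m` and the uniform superposition. -/
noncomputable def groverState {N : ℕ} (m : Fin N) (θ φ : ℝ) : EuclideanSpace ℂ (Fin N) :=
  WithLp.toLp 2 fun i => if i = m then (Real.sin φ : ℂ) else ((Real.cos φ * Real.tan θ : ℝ) : ℂ)

theorem groverState_apply_self {N : ℕ} (m : Fin N) (θ φ : ℝ) :
    groverState m θ φ m = (Real.sin φ : ℂ) := by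
  simp [groverState]

theorem groverState_apply_of_ne {N : ℕ} {m i : Fin N} (h : i ≠ m) (θ φ : ℝ) :
    groverState m θ φ i = ((Real.cos φ * Real.tan θ : ℝ) : ℂ) := by
  simp [groverState, h]

theorem uniformSuperposition_apply {N : ℕ} (i : Fin N) :
    (((Real.sqrt N)⁻¹ : ℂ) • ∑ j, EuclideanSpace.single j (1 : ℂ) :
      EuclideanSpace ℂ (Fin N)) i = ((Real.sqrt N)⁻¹ : ℂ) := by
  simp [Pi.single_apply]

theorem inner_uniformSuperposition {N : ℕ} (x : EuclideanSpace ℂ (Fin N)) :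
    ⟪((Real.sqrt N)⁻¹ : ℂ) • ∑ j, EuclideanSpace.single j (1 : ℂ), x⟫ =
      ((Real.sqrt N)⁻¹ : ℂ) * ∑ i, x i := by
  simp [EuclideanSpace.inner_single_left, mul_comm]

theorem uniformSuperposition_eq_groverState {N : ℕ} (m : Fin N) {θ : ℝ}
    (hs : Real.sin θ = (Real.sqrt N)⁻¹) (hc : Real.cos θ ≠ 0) :
    ((Real.sqrt N)⁻¹ : ℂ) • ∑ j, EuclideanSpace.single j (1 : ℂ) = groverState m θ θ := by
  ext i
  rw [uniformSuperposition_apply]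
  by_cases h : i = m
  · subst h
    rw [groverState_apply_self, hs]
    push_cast
    rfl
  · rw [groverState_apply_of_ne h, mul_comm, Real.tan_mul_cos hc, hs]
    push_cast
    rfl

/-- If `sin θ = 1 / √N` then `(N - 1) tan² θ = 1`. -/
theorem sub_one_mul_tan_sq {N : ℕ} (hN : 0 < N) {θ : ℝ}
    (hs : Real.sin θ = (Real.sqrt N)⁻¹) (hc : Real.cos θ ≠ 0) :
    ((N : ℝ) - 1) * Real.tan θ ^ 2 = 1 := by
  have hN' : (0 : ℝ) < N := by exact_mod_cast hN
  have h : (N : ℝ) * Real.sin θ ^ 2 = 1 := by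
    rw [hs, inv_pow, Real.sq_sqrt hN'.le, mul_inv_cancel₀ hN'.ne']
  rw [Real.tan_eq_sin_div_cos]
  field_simp
  linarith [Real.sin_sq_add_cos_sq θ]

/-- One Grover iteration rotates by `2θ`. -/
theorem groverStep_groverState {N : ℕ} (m : Fin N) {θ : ℝ}
    (hs : Real.sin θ = (Real.sqrt N)⁻¹) (hc : Real.cos θ ≠ 0) (φ : ℝ) :
    let π' : EuclideanSpace ℂ (Fin N) :=
      ((Real.sqrt N)⁻¹ : ℂ) • ∑ i, EuclideanSpace.single i (1 : ℂ)
    let y := groverState m θ φ - (2 * ⟪EuclideanSpace.single m (1 : ℂ), groverState m θ φ⟫) •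
      EuclideanSpace.single m (1 : ℂ)
    (2 * ⟪π', y⟫) • π' - y = groverState m θ (φ + 2 * θ) := by
  intro π' y
  have hN : 0 < N := m.pos
  have hym : y m = ((-Real.sin φ : ℝ) : ℂ) := by
    simp [y, groverState_apply_self, EuclideanSpace.inner_single_left]
    ring
  have hyi : ∀ i, i ≠ m → y i = ((Real.cos φ * Real.tan θ : ℝ) : ℂ) := fun i hi => by
    simp [y, groverState_apply_of_ne hi, hi]
  have hsum : ∑ i, y i =
      ((-Real.sin φ + ((N : ℝ) - 1) * (Real.cos φ * Real.tan θ) : ℝ) : ℂ) := by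
    rw [← Finset.add_sum_erase _ _ (Finset.mem_univ m), hym,
      Finset.sum_congr rfl fun i hi => hyi i (Finset.ne_of_mem_erase hi)]
    simp [Finset.card_erase_of_mem, Nat.cast_sub (Nat.one_le_of_lt hN)]
  have hinner : ⟪π', y⟫ = ((Real.cos (φ + θ) : ℝ) : ℂ) := by
    rw [inner_uniformSuperposition, hsum, ← Complex.ofReal_inv, ← hs, ← Complex.ofReal_mul]
    congr 1
    rw [Real.cos_add]
    have h := sub_one_mul_tan_sq hN hs hc
    rw [← Real.tan_mul_cos hc]
    linear_combination Real.cos φ * Real.cos θ * h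
  have hπ : ∀ i, π' i = ((Real.sin θ : ℝ) : ℂ) := fun i => by
    rw [uniformSuperposition_apply, hs, Complex.ofReal_inv]
  have hφ : φ = φ + θ - θ := by ring
  have hφ' : φ + 2 * θ = φ + θ + θ := by ring
  ext i
  rw [PiLp.sub_apply, PiLp.smul_apply, hinner, hπ, smul_eq_mul]
  by_cases h : i = m
  · subst h
    rw [hym, groverState_apply_self]
    norm_cast
    rw [hφ', Real.sin_add (φ + θ)]
    nth_rewrite 2 [hφ]
    rw [Real.sin_sub (φ + θ)]
    ring
  · rw [hyi i h, groverState_apply_of_ne h]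
    norm_cast
    rw [hφ', Real.cos_add (φ + θ), ← Real.tan_mul_cos hc]
    nth_rewrite 2 [hφ]
    rw [Real.cos_sub (φ + θ), ← Real.tan_mul_cos hc]
    ring

/-- `∑_{k < n} cos ((2k+1)x)` in closed form. -/
theorem two_mul_sin_mul_sum_cos (x : ℝ) (n : ℕ) :
    2 * Real.sin x * ∑ k ∈ Finset.range n, Real.cos ((2 * k + 1) * x) =
      Real.sin (2 * n * x) := by
  induction n with
  | zero => simp
  | succ n ih =>
    rw [Finset.sum_range_succ, mul_add, ih]
    have h₁ : 2 * ((n + 1 : ℕ) : ℝ) * x = (2 * n + 1) * x + x := by push_cast; ring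
    have h₂ : 2 * (n : ℝ) * x = (2 * n + 1) * x - x := by ring
    rw [h₁, h₂, Real.sin_add, Real.sin_sub]
    ring

/-- Both averages of `sin²` and `cos²` over odd multiples of `θ` are at least `1/4` as soon as the
range of angles covered is long enough. -/
theorem quarter_le_average_sin_sq_and_cos_sq {θ : ℝ} {n : ℕ} (h : 2 ≤ 2 * n * Real.sin (2 * θ)) :
    (1 / 4 ≤ 1 / (n : ℝ) * ∑ k ∈ Finset.range n, Real.sin ((2 * k + 1) * θ) ^ 2) ∧
      1 / 4 ≤ 1 / (n : ℝ) * ∑ k ∈ Finset.range n, Real.cos ((2 * k + 1) * θ) ^ 2 := by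
  have hn : (0 : ℝ) < n := by
    rcases Nat.eq_zero_or_pos n with rfl | hn
    · norm_num at h
    · exact_mod_cast hn
  have hs : 0 < Real.sin (2 * θ) := by
    by_contra! hneg
    nlinarith
  have hsum := two_mul_sin_mul_sum_cos (2 * θ) n
  set A := ∑ k ∈ Finset.range n, Real.cos ((2 * k + 1) * (2 * θ)) with hA
  have hcos : ∑ k ∈ Finset.range n, Real.cos ((2 * k + 1) * θ) ^ 2 = n / 2 + A / 2 := by
    have : ∀ k ∈ Finset.range n, Real.cos ((2 * k + 1) * θ) ^ 2 =
        1 / 2 + Real.cos ((2 * k + 1) * (2 * θ)) / 2 := fun k _ => by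
      rw [Real.cos_sq]
      ring_nf
    rw [Finset.sum_congr rfl this, Finset.sum_add_distrib, ← Finset.sum_div, ← Finset.sum_div,
      ← hA]
    simp
  have hsin : ∑ k ∈ Finset.range n, Real.sin ((2 * k + 1) * θ) ^ 2 = n / 2 - A / 2 := by
    simp only [Real.sin_sq, Finset.sum_sub_distrib, hcos]
    simp
    ring
  have hA₁ : A ≤ n / 2 := by
    by_contra! hlt
    nlinarith [Real.sin_le_one (2 * n * (2 * θ)), mul_lt_mul_of_pos_left hlt hs]
  have hA₂ : -(n / 2) ≤ A := by
    by_contra! hlt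
    nlinarith [Real.neg_one_le_sin (2 * n * (2 * θ)), mul_lt_mul_of_pos_left hlt hs]
  rw [hcos, hsin, one_div_mul_eq_div, one_div_mul_eq_div, le_div_iff₀ hn, le_div_iff₀ hn]
  constructor <;> linarith

/-- average query weight of Grover's algorithm: there exist constants
`c₁, c₂ > 0` and `N₀` such that for every `N ≥ N₀`, every marked element `m`, and every
nonnegative weight function `τ`, the weighted average of `τ` by the average query weights
`q̄_i = (1/Q) ∑_{t=1}^{Q} |⟨e_i, (U_π U_f)^{t−1}|π⟩⟩|²` (with `Q` the nearest integer to
`(π/4)√N`) is `Θ((1/(N−1)) ∑_{i≠m} τ_i + τ_m)`. -/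
theorem grover_average_query_weight :
    ∃ c₁ c₂ : ℝ, 0 < c₁ ∧ 0 < c₂ ∧ ∃ N₀ : ℕ, ∀ N : ℕ, N₀ ≤ N → ∀ m : Fin N,
      ∀ τ : Fin N → ℝ, (∀ i, 0 ≤ τ i) →
        let e : Fin N → EuclideanSpace ℂ (Fin N) := fun i => EuclideanSpace.single i 1
        let π' : EuclideanSpace ℂ (Fin N) := ((Real.sqrt N)⁻¹ : ℂ) • ∑ i, e i
        let Uf : EuclideanSpace ℂ (Fin N) → EuclideanSpace ℂ (Fin N) :=
          fun x => x - (2 * ⟪e m, x⟫) • e m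
        let Uπ : EuclideanSpace ℂ (Fin N) → EuclideanSpace ℂ (Fin N) :=
          fun x => (2 * ⟪π', x⟫) • π' - x
        let Q : ℕ := (⌊(Real.pi / 4) * Real.sqrt N + 1 / 2⌋).toNat
        let qbar : Fin N → ℝ := fun i =>
          (1 / (Q : ℝ)) * ∑ t ∈ Finset.Icc 1 Q, ‖⟪e i, (Uπ ∘ Uf)^[t - 1] π'⟫‖ ^ 2
        c₁ * ((1 / ((N : ℝ) - 1)) * ∑ i ∈ Finset.univ.filter (· ≠ m), τ i + τ m) ≤
            ∑ i, qbar i * τ i ∧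
          ∑ i, qbar i * τ i ≤
            c₂ * ((1 / ((N : ℝ) - 1)) * ∑ i ∈ Finset.univ.filter (· ≠ m), τ i + τ m) := by
  refine ⟨1 / 4, 1, by norm_num, one_pos, 16, fun N hN m τ hτ => ?_⟩
  intro e π' Uf Uπ Q qbar
  have hN' : (16 : ℝ) ≤ N := by exact_mod_cast hN
  have hsqrt : (4 : ℝ) ≤ Real.sqrt N := Real.le_sqrt_of_sq_le (by linarith)
  have hinv : (Real.sqrt N)⁻¹ ≤ 1 / 4 := by
    rw [one_div]
    exact inv_anti₀ (by norm_num) hsqrt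
  have hinv₀ : 0 < (Real.sqrt N)⁻¹ := by positivity
  obtain ⟨θ, hs, hc⟩ : ∃ θ : ℝ, Real.sin θ = (Real.sqrt N)⁻¹ ∧ 15 / 16 ≤ Real.cos θ := by
    refine ⟨Real.arcsin (Real.sqrt N)⁻¹, Real.sin_arcsin (by linarith) (by linarith), ?_⟩
    rw [Real.cos_arcsin]
    exact Real.le_sqrt_of_sq_le (by nlinarith)
  have hc₀ : Real.cos θ ≠ 0 := by linarith
  have hQ : Real.pi / 4 * Real.sqrt N - 1 / 2 ≤ (Q : ℝ) := by
    have h₁ := Int.lt_floor_add_one (Real.pi / 4 * Real.sqrt N + 1 / 2)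
    have h₂ : ((⌊Real.pi / 4 * Real.sqrt N + 1 / 2⌋ : ℤ) : ℝ) ≤ (Q : ℝ) := by
      exact_mod_cast Int.self_le_toNat _
    linarith
  have hQs : 2 ≤ 2 * Q * Real.sin (2 * θ) := by
    have h₁ : 5 / 4 / 2 ≤ (Q : ℝ) * Real.sin θ := by
      have h := mul_le_mul_of_nonneg_right hQ hinv₀.le
      rw [sub_mul, mul_assoc, mul_inv_cancel₀ (by positivity)] at h
      rw [hs]
      linarith [Real.pi_gt_three]
    rw [Real.sin_two_mul]
    nlinarith
  obtain ⟨hS, hC⟩ := quarter_le_average_sin_sq_and_cos_sq hQs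
  have hiter : ∀ k : ℕ, (Uπ ∘ Uf)^[k] π' = groverState m θ ((2 * k + 1) * θ) := by
    intro k
    induction k with
    | zero => simpa using uniformSuperposition_eq_groverState m hs hc₀
    | succ k ih =>
      rw [Function.iterate_succ_apply', ih]
      refine (groverStep_groverState m hs hc₀ _).trans ?_
      congr 1
      push_cast
      ring
  set S := 1 / (Q : ℝ) * ∑ k ∈ Finset.range Q, Real.sin ((2 * k + 1) * θ) ^ 2 with hSdef
  set C := 1 / (Q : ℝ) * ∑ k ∈ Finset.range Q, Real.cos ((2 * k + 1) * θ) ^ 2 with hCdef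
  have hQ₀ : (Q : ℝ) ≠ 0 := by
    intro h
    norm_num [h] at hQs
  have hSC : S + C = 1 := by
    rw [hSdef, hCdef, ← mul_add, ← Finset.sum_add_distrib]
    simp [hQ₀]
  have hqbar : ∀ i, qbar i = 1 / (Q : ℝ) *
      ∑ k ∈ Finset.range Q, ‖groverState m θ ((2 * k + 1) * θ) i‖ ^ 2 := by
    intro i
    simp only [qbar, e, hiter, EuclideanSpace.inner_single_left]
    rw [← Finset.Ico_add_one_right_eq_Icc, Finset.sum_Ico_eq_sum_range]
    simp
  have hqm : qbar m = S := by
    rw [hqbar]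
    simp only [groverState_apply_self, Complex.norm_real, Real.norm_eq_abs, sq_abs]
    rfl
  have hqi : ∀ i, i ≠ m → qbar i = C * (1 / ((N : ℝ) - 1)) := by
    intro i hi
    have htan : Real.tan θ ^ 2 = 1 / ((N : ℝ) - 1) :=
      eq_one_div_of_mul_eq_one_right (sub_one_mul_tan_sq m.pos hs hc₀)
    rw [hqbar]
    simp only [groverState_apply_of_ne hi, Complex.norm_real, Real.norm_eq_abs, sq_abs, mul_pow,
      htan, ← Finset.sum_mul]
    rw [← mul_assoc]
  have hsplit : ∑ i, qbar i * τ i =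
      C * (1 / ((N : ℝ) - 1) * ∑ i ∈ Finset.univ.filter (· ≠ m), τ i) + S * τ m := by
    rw [← Finset.sum_erase_add _ _ (Finset.mem_univ m), hqm, Finset.filter_ne', ← mul_assoc,
      Finset.mul_sum]
    congr 1
    exact Finset.sum_congr rfl fun i hi => by rw [hqi i (Finset.ne_of_mem_erase hi)]
  have hT : 0 ≤ 1 / ((N : ℝ) - 1) * ∑ i ∈ Finset.univ.filter (· ≠ m), τ i :=
    mul_nonneg (one_div_nonneg.2 (by linarith)) (Finset.sum_nonneg fun i _ => hτ i)
  have hm := hτ m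
  rw [hsplit]
  constructor <;> nlinarith
end
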